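/- (Boxed identity axioms in S3) For all modal formulas φ, ψ, φ', ψ', the following are theorems of the Lewis system S3: □((φ≡ψ)→(¬φ≡¬ψ)), □(((φ≡ψ)∧(φ'≡ψ'))→((φ→φ')≡(ψ→ψ'))), and □((φ≡ψ)→(□φ≡□ψ)). -/

import Mathlib

/-- Modal formulas over countably many propositional variables x₀, x₁, …. -/
inductive Fm : Type
  | var : ℕ → Fm
  | neg : Fm → Fm
  | imp : Fm → Fm → Fm
  | box : Fm → Fm
deriving DecidableEq

namespace Fm

/-- ⊤ := x₀ → x₀ -/
def top : Fm := imp (var 0) (var 0)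

/-- φ ∧ ψ := ¬(φ → ¬ψ) -/
def conj (φ ψ : Fm) : Fm := neg (imp φ (neg ψ))

/-- φ ↔ ψ := (φ → ψ) ∧ (ψ → φ) -/
def biimp (φ ψ : Fm) : Fm := conj (imp φ ψ) (imp ψ φ)

/-- strict equivalence: φ ≡ ψ := □(φ → ψ) ∧ □(ψ → φ) -/
def equiv (φ ψ : Fm) : Fm := conj (box (imp φ ψ)) (box (imp ψ φ))

/-- φ[x := ψ]: substitution of ψ for all occurrences of the variable x in φ. -/
def subst (φ : Fm) (x : ℕ) (ψ : Fm) : Fm :=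
  match φ with
  | var y => if y = x then ψ else var y
  | neg χ => neg (subst χ x ψ)
  | imp χ δ => imp (subst χ x ψ) (subst δ x ψ)
  | box χ => box (subst χ x ψ)

/-- Propositional (two-valued) evaluation of a modal formula, treating
variables and boxed formulas as atoms. -/
def pEval (v : Fm → Bool) : Fm → Bool
  | var n => v (var n)
  | neg φ => !(pEval v φ)
  | imp φ ψ => !(pEval v φ) || pEval v ψ
  | box φ => v (box φ)

/-- φ has the form of a propositional tautology, i.e. φ is a substitution
instance of a propositional tautology. -/
def isTautInstance (φ : Fm) : Prop := ∀ v : Fm → Bool, pEval v φ = true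

/-- The axioms (i)–(iii) of Lewis system S1 (Lemmon-style). -/
inductive S1Axiom : Fm → Prop
  | taut {φ} : isTautInstance φ → S1Axiom φ
  | ax2 (φ) : S1Axiom (imp (box φ) φ)
  | ax3 (φ ψ χ) :
      S1Axiom (imp (conj (box (imp φ ψ)) (box (imp ψ χ))) (box (imp φ χ)))

/-- The identity axioms (iv)–(vi), i.e. the Substitution Principle SP. -/
inductive SPAxiom : Fm → Prop
  | ax4 (φ ψ) : SPAxiom (imp (equiv φ ψ) (equiv (neg φ) (neg ψ)))
  | ax5 (φ ψ φ' ψ') :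
      SPAxiom (imp (conj (equiv φ ψ) (equiv φ' ψ'))
        (equiv (imp φ φ') (imp ψ ψ')))
  | ax6 (φ ψ) : SPAxiom (imp (equiv φ ψ) (equiv (box φ) (box ψ)))

/-- Derivability in S1+SP from a set Φ of premises: axioms (i)–(vi),
modus ponens, and Axiom Necessitation AN restricted to axioms (i)–(iii). -/
inductive S1SP : Set Fm → Fm → Prop
  | prem {Φ φ} : φ ∈ Φ → S1SP Φ φ
  | axm {Φ φ} : S1Axiom φ → S1SP Φ φ
  | spAxm {Φ φ} : SPAxiom φ → S1SP Φ φ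
  | mp {Φ φ ψ} : S1SP Φ (imp φ ψ) → S1SP Φ φ → S1SP Φ ψ
  | an {Φ φ} : S1Axiom φ → S1SP Φ (box φ)

end Fm

namespace Fm

/-- The axioms of Lewis system S3: the S1 axioms (i)–(iii) together with
the scheme (3) □(φ→ψ) → □(□φ→□ψ). -/
inductive S3Axiom : Fm → Prop
  | s1 {φ} : S1Axiom φ → S3Axiom φ
  | ax3 (φ ψ) : S3Axiom (imp (box (imp φ ψ)) (box (imp (box φ) (box ψ))))

/-- Derivability in Lewis system S3 from a set Φ of premises: axioms
(i)–(iii),(3), modus ponens, Axiom Necessitation AN applicable to all axioms,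
and Substitution of Proved Strict Equivalents SPSE. -/
inductive S3 : Set Fm → Fm → Prop
  | prem {Φ φ} : φ ∈ Φ → S3 Φ φ
  | axm {Φ φ} : S3Axiom φ → S3 Φ φ
  | mp {Φ φ ψ} : S3 Φ (imp φ ψ) → S3 Φ φ → S3 Φ ψ
  | an {Φ φ} : S3Axiom φ → S3 Φ (box φ)
  | spse {Φ} (φ : Fm) (x : ℕ) {ψ ψ'} : S3 ∅ (equiv ψ ψ') →
      S3 Φ (equiv (subst φ x ψ) (subst φ x ψ'))

end Fm

namespace Fm

theorem nT {p : Fm} (h : isTautInstance p) : S3 ∅ (box p) := .an (.s1 (.taut h))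

theorem nRK {a b : Fm} (h : S3 ∅ (box (imp a b))) : S3 ∅ (box (imp (box a) (box b))) :=
  .mp (.axm (.ax3 a b)) h

theorem nMP {a b : Fm} (h : S3 ∅ (box (imp a b))) (ha : S3 ∅ (box a)) : S3 ∅ (box b) :=
  .mp (.mp (.axm (.s1 (.ax2 _))) (nRK h)) ha

theorem nK (a b : Fm) : S3 ∅ (box (imp (box (imp a b)) (imp (box a) (box b)))) := by
  refine nMP (nMP (nT ?_) (.an (.ax3 a b))) (.an (.s1 (.ax2 (imp (box a) (box b)))))
  intro v
  simp only [pEval]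
  grind

theorem nRK2 {a b c : Fm} (h : isTautInstance (imp a (imp b c))) :
    S3 ∅ (box (imp (box a) (imp (box b) (box c)))) := by
  refine nMP (nMP (nT ?_) (nRK (nT h))) (nK b c)
  intro v
  simp only [pEval]
  grind

end Fm

open Fm in
/-- Boxed identity axioms are theorems of S3. -/
theorem boxed_identity_axioms_in_S3 (φ ψ φ' ψ' : Fm) :
    S3 ∅ (box (imp (equiv φ ψ) (equiv (neg φ) (neg ψ)))) ∧
    S3 ∅ (box (imp (conj (equiv φ ψ) (equiv φ' ψ'))
      (equiv (imp φ φ') (imp ψ ψ')))) ∧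
    S3 ∅ (box (imp (equiv φ ψ) (equiv (box φ) (box ψ)))) := by
  refine ⟨?_, ?_, ?_⟩
  · have h (a b : Fm) : S3 ∅ (box (imp (box (imp a b)) (box (imp (neg b) (neg a))))) := by
      refine nRK (nT ?_)
      intro v
      simp only [pEval]
      grind
    refine nMP (nMP (nT ?_) (h φ ψ)) (h ψ φ)
    intro v
    simp only [pEval, equiv, conj]
    grind
  · have h (a b c d : Fm) : S3 ∅ (box (imp (box (imp b a)) (imp (box (imp c d))
        (box (imp (imp a c) (imp b d)))))) := by
      refine nRK2 ?_
      intro v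
      simp only [pEval]
      grind
    refine nMP (nMP (nT ?_) (h φ ψ φ' ψ')) (h ψ φ ψ' φ')
    intro v
    simp only [pEval, equiv, conj]
    grind
  · refine nMP (nMP (nT ?_) (.an (.ax3 φ ψ))) (.an (.ax3 ψ φ))
    intro v
    simp only [pEval, equiv, conj]
    grind
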